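/- Let ν, a, s ∈ ℝ with ν ≠ 0 and let k ∈ ℤ. Suppose there exists a solution x₀ of the class-D equation with parameters (ν, a, s) such that x₀(2π) = x₀(0) + 2πk (the time-2π Poincaré map has a fixed point). Then for every solution x of the same equation, the sequence (x(2πn) − x(0))/(2πn) tends to k as n → ∞; in particular the rotation number is the integer k. -/

import Mathlib

open Real Filter

/-- A solution of the class-D equation `ẋ = ν sin x + a + s sin t`. -/
def IsClassDSolution (ν a s : ℝ) (x : ℝ → ℝ) : Prop :=
  ∀ t : ℝ, HasDerivAt x (ν * Real.sin (x t) + a + s * Real.sin t) t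

namespace IsClassDSolution

variable {ν a s : ℝ} {x y : ℝ → ℝ}

/-- Two solutions which agree at one time are equal. -/
theorem eq_of_apply_eq (hx : IsClassDSolution ν a s x) (hy : IsClassDSolution ν a s y) {t₀ : ℝ}
    (h : x t₀ = y t₀) : x = y := by
  refine ODE_solution_unique_univ (K := ‖ν‖₊) (s := fun _ => Set.univ)
    (v := fun t z => ν * Real.sin z + a + s * Real.sin t) (fun t => ?_)
    (fun t => ⟨hx t, trivial⟩) (fun t => ⟨hy t, trivial⟩) h
  refine (LipschitzWith.of_dist_le_mul fun z w => ?_).lipschitzOnWith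
  rw [Real.dist_eq, Real.dist_eq, coe_nnnorm, Real.norm_eq_abs,
    show ν * Real.sin z + a + s * Real.sin t - (ν * Real.sin w + a + s * Real.sin t)
      = ν * (Real.sin z - Real.sin w) by ring, abs_mul]
  exact mul_le_mul_of_nonneg_left (Real.abs_sin_sub_sin_le z w) (abs_nonneg ν)

theorem continuous (hx : IsClassDSolution ν a s x) : Continuous x :=
  continuous_iff_continuousAt.2 fun t => (hx t).continuousAt

/-- The order of two solutions is preserved in time. -/
theorem apply_le_apply (hx : IsClassDSolution ν a s x) (hy : IsClassDSolution ν a s y) {t₀ : ℝ}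
    (h : x t₀ ≤ y t₀) (t : ℝ) : x t ≤ y t := by
  by_contra! hlt
  obtain ⟨c, hc⟩ := mem_range_of_exists_le_of_exists_ge (hx.continuous.sub hy.continuous)
    ⟨t₀, sub_nonpos.2 h⟩ ⟨t, (sub_pos.2 hlt).le⟩
  exact hlt.ne (congrFun (hx.eq_of_apply_eq hy (sub_eq_zero.1 hc)) t).symm

/-- The equation is invariant under `x ↦ x + 2πm`. -/
theorem add_int_mul_two_pi (hx : IsClassDSolution ν a s x) (m : ℤ) :
    IsClassDSolution ν a s (fun t => x t + m * (2 * π)) := fun t => by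
  simpa only [Real.sin_add_int_mul_two_pi] using (hx t).add_const (m * (2 * π))

/-- The equation is invariant under `t ↦ t + 2π`. -/
theorem comp_add_two_pi (hx : IsClassDSolution ν a s x) :
    IsClassDSolution ν a s (fun t => x (t + 2 * π)) := fun t => by
  simpa only [Real.sin_add_two_pi] using (hx (t + 2 * π)).comp_add_const t (2 * π)

/-- A solution that advances by `2πk` over the first period does so over every period. -/
theorem apply_two_pi_mul_nat (hx : IsClassDSolution ν a s x) {k : ℤ}
    (hk : x (2 * π) = x 0 + 2 * π * k) (n : ℕ) :
    x (2 * π * n) = x 0 + 2 * π * k * n := by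
  have hper : (fun t => x (t + 2 * π)) = fun t => x t + k * (2 * π) :=
    hx.comp_add_two_pi.eq_of_apply_eq (hx.add_int_mul_two_pi k) (t₀ := 0) (by
      simp only [zero_add]
      rw [hk]
      ring)
  induction n with
  | zero => simp
  | succ n ih =>
    have hstep : x (2 * π * n + 2 * π) = x (2 * π * n) + k * (2 * π) := congrFun hper (2 * π * n)
    push_cast
    rw [mul_add_one, hstep, ih]
    ring

/-- If some solution advances by `2πk` over a period, then every solution advances by `2πkn` over
`n` periods, up to an error of at most `2π`. -/
theorem abs_sub_sub_le (hx : IsClassDSolution ν a s x) (hy : IsClassDSolution ν a s y) {k : ℤ}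
    (hk : y (2 * π) = y 0 + 2 * π * k) (n : ℕ) :
    |x (2 * π * n) - x 0 - 2 * π * k * n| ≤ 2 * π := by
  let m : ℤ := ⌊(x 0 - y 0) / (2 * π)⌋
  have hm : m * (2 * π) ≤ x 0 - y 0 := (le_div_iff₀ Real.two_pi_pos).1 (Int.floor_le _)
  have hm' : x 0 - y 0 < (m + 1) * (2 * π) :=
    (div_lt_iff₀ Real.two_pi_pos).1 (Int.lt_floor_add_one _)
  have hlower := (hy.add_int_mul_two_pi m).apply_le_apply hx (t₀ := 0) (by linarith) (2 * π * n)
  have hupper := hx.apply_le_apply (hy.add_int_mul_two_pi (m + 1)) (t₀ := 0)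
    (by push_cast; linarith) (2 * π * n)
  push_cast at hupper
  rw [hy.apply_two_pi_mul_nat hk n] at hlower hupper
  rw [abs_le]
  constructor <;> linarith

end IsClassDSolution

/-- If some solution `x₀` of the class-D equation satisfies `x₀(2π) = x₀(0) + 2πk` (the
time-`2π` Poincaré map has a fixed point), then for every solution `x` the sequence
`(x(2πn) - x(0))/(2πn)` tends to `k`: the rotation number is the integer `k`. -/
theorem classD_fixed_point_implies_integer_rotation_number
    (ν a s : ℝ) (hν : ν ≠ 0) (k : ℤ)
    (hfix : ∃ x₀ : ℝ → ℝ, IsClassDSolution ν a s x₀ ∧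
      x₀ (2 * π) = x₀ 0 + 2 * π * (k : ℝ)) :
    ∀ x : ℝ → ℝ, IsClassDSolution ν a s x →
      Tendsto (fun n : ℕ => (x (2 * π * n) - x 0) / (2 * π * n)) atTop (nhds (k : ℝ)) := by
  obtain ⟨x₀, hx₀, hk⟩ := hfix
  intro x hx
  refine tendsto_iff_norm_sub_tendsto_zero.2 (squeeze_zero' (.of_forall fun _ => norm_nonneg _)
    ?_ tendsto_one_div_atTop_nhds_zero_nat)
  filter_upwards [eventually_gt_atTop 0] with n hn
  have hn' : (0 : ℝ) < n := Nat.cast_pos.2 hn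
  have hpos : 0 < 2 * π * n := mul_pos Real.two_pi_pos hn'
  have hdiv : (x (2 * π * n) - x 0) / (2 * π * n) - k
      = (x (2 * π * n) - x 0 - 2 * π * k * n) / (2 * π * n) := by
    field_simp
  rw [hdiv, Real.norm_eq_abs, abs_div, abs_of_pos hpos, div_le_div_iff₀ hpos hn', one_mul]
  exact mul_le_mul_of_nonneg_right (hx.abs_sub_sub_le hx₀ hk n) hn'.le
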